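/- For every L ≥ 0, k ≥ 0 and h₀ ≥ 0 there exist β, γ ≥ 0 such that the following holds. Let (X, d) be a metric space with a coarse median μ with parameters (k, h) where h(0) = h₀, let (M, μ_M) be a finite median algebra, and let f : M → X be an L-quasi-morphism, i.e. d(f(μ_M(a,b,c)), μ(f(a), f(b), f(c))) ≤ L for all a, b, c ∈ M. If x₀, x₁, …, x_m ∈ M is a combinatorial geodesic, i.e. consecutive points xᵢ, xᵢ₊₁ are adjacent and m equals the number of walls of M separating x₀ and x_m, then d(f(xᵢ), f(xᵢ₊₁)) ≤ β·d(f(x₀), f(x_m)) + γ for all i ∈ {0, …, m−1}. -/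

import Mathlib

universe u v

/-- The axioms of a median algebra for a ternary operation. -/
def IsMedianFn {X : Type*} (μ : X → X → X → X) : Prop :=
  (∀ x y z, μ x y z = μ x z y) ∧ (∀ x y z, μ x y z = μ y z x) ∧
    (∀ x y, μ x x y = x) ∧
    ∀ x y z u v, μ (μ x y z) u v = μ x (μ y u v) (μ z u v)

/-- `μ` is a coarse median on `(X, d)` with parameters `(k, h)`. -/
def IsCoarseMedianWith {X : Type*} [MetricSpace X] (μ : X → X → X → X)
    (k : ℝ) (h : ℕ → ℝ) : Prop :=
  0 ≤ k ∧ (∀ i, 0 ≤ h i) ∧ Monotone h ∧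
    (∀ x y z x' y' z' : X,
      dist (μ x y z) (μ x' y' z') ≤ k * (dist x x' + dist y y' + dist z z') + h 0) ∧
    ∀ A : Finset X, A.Nonempty →
      ∃ (M : Type) (_ : Fintype M) (μM : M → M → M → M) (lam : M → X) (proj : X → M),
        IsMedianFn μM ∧
          (∀ a ∈ A, dist a (lam (proj a)) ≤ h A.card) ∧
          ∀ m₁ m₂ m₃ : M,
            dist (lam (μM m₁ m₂ m₃)) (μ (lam m₁) (lam m₂) (lam m₃)) ≤ h A.card

/-- `μ` is a coarse median on `(X, d)`. -/
def IsCoarseMedian {X : Type*} [MetricSpace X] (μ : X → X → X → X) : Prop :=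
  ∃ k h, IsCoarseMedianWith μ k h

/-- `f` is a quasi-isometric embedding. -/
def IsQIE {X Y : Type*} [MetricSpace X] [MetricSpace Y] (f : X → Y) : Prop :=
  ∃ α ε : ℝ, 0 < α ∧ 0 ≤ ε ∧ ∀ x x' : X,
    α⁻¹ * dist x x' - ε ≤ dist (f x) (f x') ∧ dist (f x) (f x') ≤ α * dist x x' + ε

/-- `f` is a quasi-isometry with quasi-inverse `g`. -/
def IsQuasiInverse {X Y : Type*} [MetricSpace X] [MetricSpace Y]
    (f : X → Y) (g : Y → X) : Prop :=
  IsQIE f ∧ IsQIE g ∧ (∃ C, ∀ y, dist (f (g y)) y ≤ C) ∧ ∃ C, ∀ x, dist (g (f x)) x ≤ C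

/-- A subset of a median algebra is convex if it contains the interval
`I(a,b) = {z | μ a b z = z}` between any two of its points. -/
def MedConvex {M : Type*} (μM : M → M → M → M) (h : Set M) : Prop :=
  ∀ a ∈ h, ∀ b ∈ h, ∀ z : M, μM a b z = z → z ∈ h

/-- A halfspace: one side of a wall, i.e. a nonempty convex set with nonempty convex
complement.  Walls `{h, hᶜ}` correspond to pairs of complementary halfspaces. -/
def IsHalfspace {M : Type*} (μM : M → M → M → M) (h : Set M) : Prop :=
  h.Nonempty ∧ hᶜ.Nonempty ∧ MedConvex μM h ∧ MedConvex μM hᶜ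

/-- `a` and `b` are adjacent (form an edge) if exactly one wall separates them; separating
walls are represented by the halfspace containing `a` and not `b`. -/
def Adjacent {M : Type*} (μM : M → M → M → M) (a b : M) : Prop :=
  ∃! h : Set M, IsHalfspace μM h ∧ a ∈ h ∧ b ∉ h

/-- The edge `{a, b}` crosses the wall `{w, wᶜ}`: `a, b` are adjacent and the wall
separates them. -/
def EdgeCrosses {M : Type*} (μM : M → M → M → M) (w : Set M) (a b : M) : Prop :=
  Adjacent μM a b ∧ ((a ∈ w ∧ b ∉ w) ∨ (b ∈ w ∧ a ∉ w))

namespace IsMedianFn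

variable {M : Type*} {μM : M → M → M → M}

theorem rotate (hM : IsMedianFn μM) (x y z : M) : μM x y z = μM y z x := hM.2.1 x y z

theorem swap_right (hM : IsMedianFn μM) (x y z : M) : μM x y z = μM x z y := hM.1 x y z

theorem swap_left (hM : IsMedianFn μM) (x y z : M) : μM x y z = μM y x z := by
  rw [hM.rotate, hM.swap_right]

theorem left_left (hM : IsMedianFn μM) (x y : M) : μM x x y = x := hM.2.2.1 x y

theorem right_right (hM : IsMedianFn μM) (x y : M) : μM y x x = x := by
  rw [hM.rotate, hM.left_left]

theorem distrib (hM : IsMedianFn μM) (x y z u v : M) :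
    μM (μM x y z) u v = μM x (μM y u v) (μM z u v) := hM.2.2.2 x y z u v

/-- The median of `x, y, z` lies in the interval `I(x, y)`. -/
theorem median_mem_interval (hM : IsMedianFn μM) (x y z : M) :
    μM x y (μM x y z) = μM x y z := by
  rw [← hM.rotate (μM x y z) x y, ← hM.rotate z x y, hM.distrib, hM.left_left, hM.swap_left y x y,
    hM.right_right]

/-- Membership in intervals with a common endpoint is transitive. -/
theorem interval_trans (hM : IsMedianFn μM) {c p e f : M} (he : μM c p e = e)
    (hf : μM c e f = f) : μM c p f = f := by
  have hf' : μM f c e = f := by rw [hM.rotate, hf]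
  have he' : μM e c p = e := by rw [hM.rotate, he]
  calc μM c p f = μM (μM f c e) c p := by rw [hf', ← hM.rotate f c p]
    _ = f := by rw [hM.distrib, hM.left_left, he', hf']

/-- If `I(c, e) = {c, e}` then the points projecting to `c` form a halfspace. -/
theorem isHalfspace_of_interval_eq_pair (hM : IsMedianFn μM) {c e : M} (hne : e ≠ c)
    (hI : ∀ z, μM c e z = z → z = c ∨ z = e) : IsHalfspace μM {x | μM x c e = c} := by
  have hproj : ∀ x, μM x c e = c ∨ μM x c e = e := fun x => hI _ (by
    rw [hM.rotate x c e, hM.median_mem_interval])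
  have hconv : ∀ q : M, MedConvex μM {x | μM x c e = q} := by
    intro q x hx y hy z hz
    simp only [Set.mem_ofPred_eq] at *
    rw [← hz, ← hM.rotate z x y, hM.distrib, hx, hy, hM.right_right]
  refine ⟨⟨c, hM.left_left c e⟩, ⟨e, ?_⟩, hconv c, ?_⟩
  · simp only [Set.mem_compl_iff, Set.mem_ofPred_eq]
    rwa [hM.rotate, hM.right_right]
  · have : {x | μM x c e = c}ᶜ = {x | μM x c e = e} := by
      ext x
      simp only [Set.mem_compl_iff, Set.mem_ofPred_eq]
      exact ⟨(hproj x).resolve_left, fun h => by rwa [h]⟩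
    exact this ▸ hconv e

/-- Distinct points of a finite median algebra are separated by a halfspace. -/
theorem exists_isHalfspace [Finite M] (hM : IsMedianFn μM) {c p : M} (hne : p ≠ c) :
    ∃ H, IsHalfspace μM H ∧ c ∈ H ∧ p ∉ H := by
  induction hn : {z | μM c p z = z}.ncard using Nat.strong_induction_on generalizing p with
  | _ n ih =>
    by_cases hI : ∀ z, μM c p z = z → z = c ∨ z = p
    · refine ⟨_, hM.isHalfspace_of_interval_eq_pair hne hI, hM.left_left c p, ?_⟩
      simp only [Set.mem_ofPred_eq]
      rwa [hM.rotate, hM.right_right]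
    · push Not at hI
      obtain ⟨e, he, hec, hep⟩ := hI
      have hlt : {z | μM c e z = z}.ncard < n := by
        rw [← hn]
        refine Set.ncard_lt_ncard ⟨fun z hz => hM.interval_trans he hz, fun hsub => hep ?_⟩
          (Set.toFinite _)
        have hpe : μM c e p = p := hsub (hM.right_right p c)
        rw [← he, hM.swap_right, hpe]
      obtain ⟨H, hH, hcH, heH⟩ := ih _ hlt hec rfl
      exact ⟨H, hH, hcH, fun hpH => heH (hH.2.2.1 c hcH p hpH e he)⟩

end IsMedianFn

/-- If the unique halfspace containing `c` but not `d` also contains `a`, then `c` is the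
median of `a, c, d`. -/
theorem Adjacent.median_eq_left {M : Type*} [Finite M] {μM : M → M → M → M}
    (hM : IsMedianFn μM) {a c d : M} (hcd : Adjacent μM c d) {H : Set M}
    (hH : IsHalfspace μM H) (hc : c ∈ H) (hd : d ∉ H) (ha : a ∈ H) : μM a c d = c := by
  by_contra hne
  obtain ⟨K, hK, hcK, hpK⟩ := hM.exists_isHalfspace hne
  have hdK : d ∉ K := fun hdK => hpK (hK.2.2.1 c hcK d hdK _ (by
    rw [hM.rotate a c d, hM.median_mem_interval]))
  obtain rfl : K = H := hcd.unique ⟨hK, hcK, hdK⟩ ⟨hH, hc, hd⟩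
  exact hpK (hK.2.2.1 a ha c hcK _ (hM.median_mem_interval a c d))

/-- If the complement of the unique halfspace containing `c` but not `d` also contains `b`, then
`d` is the median of `b, c, d`. -/
theorem Adjacent.median_eq_right {M : Type*} [Finite M] {μM : M → M → M → M}
    (hM : IsMedianFn μM) {b c d : M} (hcd : Adjacent μM c d) {H : Set M}
    (hH : IsHalfspace μM H) (hc : c ∈ H) (hd : d ∉ H) (hb : b ∉ H) : μM b c d = d := by
  by_contra hne
  obtain ⟨K, hK, hqK, hdK⟩ := hM.exists_isHalfspace (Ne.symm hne)
  have hcK : c ∈ K := by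
    by_contra hcK
    exact hK.2.2.2 c hcK d hdK _ (by rw [hM.rotate b c d, hM.median_mem_interval]) hqK
  obtain rfl : K = H := hcd.unique ⟨hK, hcK, hdK⟩ ⟨hH, hc, hd⟩
  exact hK.2.2.2 b hb d hd _ (by rw [hM.swap_right b c d, hM.median_mem_interval]) hqK

/-- Each halfspace crossed by an edge of a combinatorial geodesic separates its endpoints. -/
theorem exists_isHalfspace_of_geodesic {M : Type*} [Finite M] {μM : M → M → M → M} {m : ℕ}
    {x : Fin (m + 1) → M} (hadj : ∀ i : Fin m, Adjacent μM (x i.castSucc) (x i.succ))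
    (hm : m = {h : Set M | IsHalfspace μM h ∧ x 0 ∈ h ∧ x (Fin.last m) ∉ h}.ncard)
    (i : Fin m) :
    ∃ H, IsHalfspace μM H ∧ x i.castSucc ∈ H ∧ x i.succ ∉ H ∧ x 0 ∈ H ∧ x (Fin.last m) ∉ H := by
  choose H hH using fun i => (hadj i).exists
  have hsub : {h : Set M | IsHalfspace μM h ∧ x 0 ∈ h ∧ x (Fin.last m) ∉ h} ⊆ Set.range H := by
    rintro h ⟨hh, h0, hlast⟩
    obtain ⟨j, hj, hj'⟩ : ∃ j : Fin m, x j.castSucc ∈ h ∧ x j.succ ∉ h := by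
      by_contra! hstep
      exact hlast (Fin.induction (motive := fun j => x j ∈ h) h0 hstep (Fin.last m))
    exact ⟨j, (hadj j).unique (hH j) ⟨hh, hj, hj'⟩⟩
  have hcard : (Set.range H).ncard ≤ m := by
    simpa [Set.image_univ] using Set.ncard_image_le (f := H) (Set.toFinite Set.univ)
  have heq := Set.eq_of_subset_of_ncard_le hsub (hcard.trans hm.le) (Set.toFinite _)
  obtain ⟨-, h0, hlast⟩ := heq.symm ▸ Set.mem_range_self (f := H) i
  exact ⟨H i, (hH i).1, (hH i).2.1, (hH i).2.2, h0, hlast⟩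

/-- For every `L ≥ 0`, `k ≥ 0`, `h₀ ≥ 0` there are `β, γ ≥ 0` such that for
every coarse median `μ` with parameters `(k, h)`, `h 0 = h₀`, every finite median algebra
`(M, μM)` and every `L`-quasi-morphism `f : M → X`, along any combinatorial geodesic
`x₀, …, x_m` of `M` (consecutive points adjacent, and `m` equal to the number of walls of
`M` separating `x₀` from `x_m`) one has
`d(f xᵢ, f xᵢ₊₁) ≤ β·d(f x₀, f x_m) + γ` for all `i`. -/
theorem stmt_18 (L k h₀ : ℝ) (hL : 0 ≤ L) (hk : 0 ≤ k) (hh₀ : 0 ≤ h₀) :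
    ∃ β γ : ℝ, 0 ≤ β ∧ 0 ≤ γ ∧
      ∀ (X : Type u) [MetricSpace X] (μ : X → X → X → X) (h : ℕ → ℝ),
        IsCoarseMedianWith μ k h → h 0 = h₀ →
        ∀ (M : Type v) [Fintype M] (μM : M → M → M → M), IsMedianFn μM →
          ∀ f : M → X, (∀ a b c : M, dist (f (μM a b c)) (μ (f a) (f b) (f c)) ≤ L) →
            ∀ (m : ℕ) (x : Fin (m + 1) → M),
              (∀ i : Fin m, Adjacent μM (x i.castSucc) (x i.succ)) →
              m = {h : Set M | IsHalfspace μM h ∧ x 0 ∈ h ∧ x (Fin.last m) ∉ h}.ncard →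
              ∀ i : Fin m,
                dist (f (x i.castSucc)) (f (x i.succ)) ≤
                  β * dist (f (x 0)) (f (x (Fin.last m))) + γ := by
  refine ⟨k, 2 * L + h₀, hk, by positivity, ?_⟩
  intro X _ μ h hμ hh M _ μM hM f hf m x hadj hm i
  obtain ⟨H, hH, hc, hd, ha, hb⟩ := exists_isHalfspace_of_geodesic hadj hm i
  have hleft := hf (x 0) (x i.castSucc) (x i.succ)
  have hright := hf (x (Fin.last m)) (x i.castSucc) (x i.succ)
  rw [(hadj i).median_eq_left hM hH hc hd ha] at hleft
  rw [(hadj i).median_eq_right hM hH hc hd hb, dist_comm] at hright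
  have hlip := hμ.2.2.2.1 (f (x 0)) (f (x i.castSucc)) (f (x i.succ))
    (f (x (Fin.last m))) (f (x i.castSucc)) (f (x i.succ))
  simp only [dist_self, add_zero, hh] at hlip
  linarith [dist_triangle4 (f (x i.castSucc))
    (μ (f (x 0)) (f (x i.castSucc)) (f (x i.succ)))
    (μ (f (x (Fin.last m))) (f (x i.castSucc)) (f (x i.succ))) (f (x i.succ))]
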